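/- Let n, m ∈ ℕ, let R be the subring of the ring of germs at 0 of ℂ-valued functions on ℂⁿ consisting of germs of functions analytic at 0, with I₀ ⊆ R the ideal of analytic germs vanishing at 0, and let A := R ⊗_ℂ Λ, where Λ is the exterior algebra of ℂ^m over ℂ. Let J₀ be the two-sided ideal of A generated by the elements r ⊗ 1 with r ∈ I₀ and the elements 1 ⊗ ι(v) for v ∈ ℂ^m. Then a two-sided ideal J of A has finite codimension (i.e. A / J is a finite-dimensional ℂ-vector space) if and only if there exists an integer p > 0 with J₀^p ⊆ J. -/

import Mathlib

open Filter Topology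
open scoped TensorProduct

/-- The subring of the ring of germs at `0` of `ℂ`-valued functions on `ℂⁿ` consisting of
germs of functions analytic at `0`. -/
noncomputable def analyticGerms (n : ℕ) :
    Subring (Filter.Germ (𝓝 (0 : Fin n → ℂ)) ℂ) where
  carrier := {φ | ∃ f : (Fin n → ℂ) → ℂ, AnalyticAt ℂ f 0 ∧ φ = ↑f}
  zero_mem' := ⟨fun _ => 0, analyticAt_const, rfl⟩
  one_mem' := ⟨fun _ => 1, analyticAt_const, rfl⟩
  add_mem' := by
    rintro a b ⟨f, hf, rfl⟩ ⟨g, hg, rfl⟩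
    exact ⟨fun x => f x + g x, hf.add hg, rfl⟩
  neg_mem' := by
    rintro a ⟨f, hf, rfl⟩
    exact ⟨fun x => -f x, hf.neg, rfl⟩
  mul_mem' := by
    rintro a b ⟨f, hf, rfl⟩ ⟨g, hg, rfl⟩
    exact ⟨fun x => f x * g x, hf.mul hg, rfl⟩

/-- Evaluation at `0` of an analytic germ at `0`, as a ring homomorphism. -/
noncomputable def evalAtZero (n : ℕ) : analyticGerms n →+* ℂ where
  toFun φ := Filter.Germ.liftOn φ.1 (fun f => f 0) fun _ _ H => H.eq_of_nhds
  map_one' := rfl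
  map_zero' := rfl
  map_mul' φ ψ := by
    obtain ⟨f, hf, hφ⟩ := φ.2
    obtain ⟨g, hg, hψ⟩ := ψ.2
    have h1 : (φ * ψ : analyticGerms n).1 = ((fun x => f x * g x : (Fin n → ℂ) → ℂ) :
        Filter.Germ (𝓝 (0 : Fin n → ℂ)) ℂ) := by
      show (φ.1 * ψ.1) = _
      rw [hφ, hψ]; rfl
    show Filter.Germ.liftOn (φ * ψ : analyticGerms n).1 _ _ =
      Filter.Germ.liftOn φ.1 (fun f => f 0) (fun _ _ H => H.eq_of_nhds) *
        Filter.Germ.liftOn ψ.1 (fun f => f 0) (fun _ _ H => H.eq_of_nhds)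
    rw [h1, hφ, hψ]
    rfl
  map_add' φ ψ := by
    obtain ⟨f, hf, hφ⟩ := φ.2
    obtain ⟨g, hg, hψ⟩ := ψ.2
    have h1 : (φ + ψ : analyticGerms n).1 = ((fun x => f x + g x : (Fin n → ℂ) → ℂ) :
        Filter.Germ (𝓝 (0 : Fin n → ℂ)) ℂ) := by
      show (φ.1 + ψ.1) = _
      rw [hφ, hψ]; rfl
    show Filter.Germ.liftOn (φ + ψ : analyticGerms n).1 _ _ =
      Filter.Germ.liftOn φ.1 (fun f => f 0) (fun _ _ H => H.eq_of_nhds) +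
        Filter.Germ.liftOn ψ.1 (fun f => f 0) (fun _ _ H => H.eq_of_nhds)
    rw [h1, hφ, hψ]
    rfl

/-- The constant germs, as a ring homomorphism `ℂ →+* analyticGerms n`. -/
noncomputable def constGerm (n : ℕ) : ℂ →+* analyticGerms n where
  toFun c := ⟨((fun _ => c : (Fin n → ℂ) → ℂ) : Filter.Germ (𝓝 (0 : Fin n → ℂ)) ℂ),
    ⟨fun _ => c, analyticAt_const, rfl⟩⟩
  map_one' := rfl
  map_zero' := rfl
  map_mul' _ _ := rfl
  map_add' _ _ := rfl

noncomputable instance (n : ℕ) : Algebra ℂ (analyticGerms n) := (constGerm n).toAlgebra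

/-- The ideal of analytic germs at `0` vanishing at `0`. -/
noncomputable def vanishingIdeal (n : ℕ) : Ideal (analyticGerms n) :=
  RingHom.ker (evalAtZero n)

/-- The stalk at the origin of the structure sheaf of the analytic supermanifold
`ℂ^{n|m}`: analytic germs at `0 ∈ ℂⁿ` tensored with the exterior algebra of `ℂᵐ`. -/
noncomputable abbrev SuperStalk (n m : ℕ) : Type :=
  analyticGerms n ⊗[ℂ] ExteriorAlgebra ℂ (Fin m → ℂ)

/-- The product of two two-sided ideals: the two-sided ideal generated by products. -/
noncomputable def tsiMul {A : Type*} [Ring A] (I J : TwoSidedIdeal A) : TwoSidedIdeal A :=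
  TwoSidedIdeal.span {x | ∃ a ∈ I, ∃ b ∈ J, x = a * b}

/-- Powers of a two-sided ideal. -/
noncomputable def tsiPow {A : Type*} [Ring A] (I : TwoSidedIdeal A) : ℕ → TwoSidedIdeal A
  | 0 => ⊤
  | 1 => I
  | (p + 2) => tsiMul (tsiPow I (p + 1)) I

/-- The underlying `ℂ`-submodule of a two-sided ideal in a `ℂ`-algebra. -/
noncomputable def tsiToSubmodule {A : Type*} [Ring A] [Algebra ℂ A]
    (J : TwoSidedIdeal A) : Submodule ℂ A where
  carrier := J
  zero_mem' := J.zero_mem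
  add_mem' := fun ha hb => J.add_mem ha hb
  smul_mem' := fun c x hx => by
    rw [Algebra.smul_def]
    exact J.mul_mem_left _ _ hx

/-- The maximal two-sided ideal of the stalk of `ℂ^{n|m}` at the origin: the two-sided
ideal generated by the `r ⊗ 1` with `r` an analytic germ vanishing at `0`, together with
the `1 ⊗ ι v` for `v ∈ ℂᵐ`. -/
noncomputable def superVanishingIdeal (n m : ℕ) : TwoSidedIdeal (SuperStalk n m) :=
  TwoSidedIdeal.span
    ({x | ∃ r ∈ vanishingIdeal n, x = r ⊗ₜ[ℂ] (1 : ExteriorAlgebra ℂ (Fin m → ℂ))} ∪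
     {x | ∃ v : Fin m → ℂ, x = (1 : analyticGerms n) ⊗ₜ[ℂ] ExteriorAlgebra.ι ℂ v})


/-- Hadamard's lemma: an analytic germ differs from its value at `0` by a combination of the
coordinates with analytic coefficients. -/
theorem AnalyticAt.exists_eventuallyEq_add_sum {n : ℕ} {f : (Fin n → ℂ) → ℂ}
    (hf : AnalyticAt ℂ f 0) :
    ∃ g : Fin n → (Fin n → ℂ) → ℂ, (∀ i, AnalyticAt ℂ (g i) 0) ∧
      f =ᶠ[𝓝 0] fun x => f 0 + ∑ i, x i * g i x := by
  obtain ⟨p, r, hp⟩ := hf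
  have hr : 0 < p.shift.radius := by
    rw [FormalMultilinearSeries.radius_shift]; exact hp.r_pos.trans_le hp.r_le
  have hq := p.shift.hasFPowerSeriesOnBall hr
  refine ⟨fun i x => p.shift.sum x (Pi.single i 1), fun i => ?_, ?_⟩
  · exact ((ContinuousLinearMap.apply ℂ ℂ (Pi.single i (1 : ℂ) : Fin n → ℂ)).analyticAt _).comp
      hq.analyticAt
  · filter_upwards [Metric.eball_mem_nhds (0 : Fin n → ℂ) hp.r_pos,
      Metric.eball_mem_nhds (0 : Fin n → ℂ) hr] with x hx hx'
    have h1 := hp.hasSum hx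
    have h2 := (ContinuousLinearMap.apply ℂ ℂ x).hasSum (hq.hasSum hx')
    rw [zero_add] at h1 h2
    have h3 := (hasSum_nat_add_iff' 1).2 h1
    have h4 : f x - f 0 = p.shift.sum x x := by
      refine HasSum.unique ?_ h2
      convert h3 using 1
      · funext k
        have h : (Fin.snoc (fun _ => x) x : Fin (k + 1) → Fin n → ℂ) = fun _ => x := by
          funext j
          induction j using Fin.lastCases <;> simp
        simp [FormalMultilinearSeries.shift, ContinuousMultilinearMap.curryRight_apply, h]
      · simp [hp.coeff_zero]
    have h5 : p.shift.sum x x = ∑ i, x i * p.shift.sum x (Pi.single i 1) := by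
      conv_lhs => enter [2]; rw [pi_eq_sum_univ' x]
      simp [map_sum]
    rw [← h5, ← h4]; ring

/-- The germs at `0` of the coordinate functions. -/
noncomputable def coordGerm (n : ℕ) (i : Fin n) : analyticGerms n :=
  ⟨((fun x => x i : (Fin n → ℂ) → ℂ) : Filter.Germ (𝓝 (0 : Fin n → ℂ)) ℂ),
    fun x => x i, (ContinuousLinearMap.proj (R := ℂ) (φ := fun _ : Fin n => ℂ) i).analyticAt 0,
    rfl⟩

theorem coordGerm_mem_vanishingIdeal (n : ℕ) (i : Fin n) : coordGerm n i ∈ vanishingIdeal n :=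
  RingHom.mem_ker.2 (show ((0 : Fin n → ℂ) i : ℂ) = 0 from rfl)

theorem analyticGerms_top_eq (n : ℕ) :
    (⊤ : Submodule ℂ (analyticGerms n)) =
      1 + Submodule.span ℂ (Set.range (coordGerm n)) * ⊤ := by
  refine le_antisymm ?_ le_top
  rintro ⟨φ, f, hf, rfl⟩ -
  obtain ⟨g, hg, hfg⟩ := hf.exists_eventuallyEq_add_sum
  let G : Fin n → analyticGerms n := fun i => ⟨(g i : Filter.Germ _ ℂ), g i, hg i, rfl⟩
  have key : (⟨(f : Filter.Germ _ ℂ), f, hf, rfl⟩ : analyticGerms n) =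
      algebraMap ℂ (analyticGerms n) (f 0) + ∑ i, coordGerm n i * G i := by
    apply Subtype.ext
    push_cast
    change _ = Filter.Germ.coeRingHom (𝓝 0) (fun _ => f 0) +
      ∑ i, Filter.Germ.coeRingHom (𝓝 0) (fun x : Fin n → ℂ => x i) *
        Filter.Germ.coeRingHom (𝓝 0) (g i)
    simp only [← map_mul, ← map_sum, ← map_add]
    refine Filter.Germ.coe_eq.2 ?_
    filter_upwards [hfg] with x hx
    simpa using hx
  rw [key]
  exact Submodule.add_mem_sup (Submodule.algebraMap_mem _) (Submodule.sum_mem _ fun i _ =>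
    Submodule.mul_mem_mul (Submodule.subset_span ⟨i, rfl⟩) trivial)

theorem isUnit_of_evalAtZero_ne_zero {n : ℕ} {φ : analyticGerms n} (h : evalAtZero n φ ≠ 0) :
    IsUnit φ := by
  obtain ⟨φ, f, hf, rfl⟩ := φ
  have h0 : f 0 ≠ 0 := h
  refine IsUnit.of_mul_eq_one ⟨(f⁻¹ : (Fin n → ℂ) → ℂ), f⁻¹, hf.inv h0, rfl⟩ (Subtype.ext ?_)
  refine Filter.Germ.coe_eq.2 ?_
  filter_upwards [hf.continuousAt.eventually_ne h0] with x hx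
  exact mul_inv_cancel₀ hx

theorem exteriorAlgebra_top_eq (V : Type*) [AddCommGroup V] [Module ℂ V] :
    (⊤ : Submodule ℂ (ExteriorAlgebra ℂ V)) =
      1 + LinearMap.range (ExteriorAlgebra.ι ℂ (M := V)) * ⊤ := by
  refine le_antisymm (fun a _ => ?_) le_top
  set E := LinearMap.range (ExteriorAlgebra.ι ℂ (M := V))
  induction a using ExteriorAlgebra.induction with
  | algebraMap r => exact Submodule.mem_sup_left (Submodule.algebraMap_mem r)
  | ι x =>
    refine Submodule.mem_sup_right ?_
    rw [← mul_one (ExteriorAlgebra.ι ℂ x)]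
    exact Submodule.mul_mem_mul ⟨x, rfl⟩ trivial
  | mul a b ha hb =>
    have : (1 + E * ⊤) * (1 + E * ⊤) ≤ 1 + E * ⊤ := by
      rw [add_mul, one_mul, mul_assoc]
      exact sup_le le_rfl (le_sup_of_le_right (mul_le_mul' le_rfl le_top))
    exact this (Submodule.mul_mem_mul (ha trivial) (hb trivial))
  | add a b ha hb => exact Submodule.add_mem _ (ha trivial) (hb trivial)

theorem map_mem_one_add_mul_top {A B : Type*} [Ring A] [Ring B] [Algebra ℂ A] [Algebra ℂ B]
    {X : Submodule ℂ A} {Y : Submodule ℂ B} (hX : (⊤ : Submodule ℂ A) = 1 + X * ⊤)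
    (f : A →ₐ[ℂ] B) (h : X.map f.toLinearMap ≤ Y) (a : A) : f a ∈ 1 + Y * ⊤ := by
  have ha : a ∈ 1 + X * ⊤ := hX ▸ trivial
  have hfa := Submodule.mem_map_of_mem (f := f.toLinearMap) ha
  rw [Submodule.add_eq_sup, Submodule.map_sup, Submodule.map_mul, Submodule.map_one] at hfa
  have hle : 1 ⊔ X.map f.toLinearMap * (⊤ : Submodule ℂ A).map f.toLinearMap ≤ 1 + Y * ⊤ :=
    sup_le_sup le_rfl (mul_le_mul' h le_top)
  exact hle hfa

open Algebra.TensorProduct in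
theorem tensorProduct_top_eq {R S : Type*} [CommRing R] [Ring S] [Algebra ℂ R] [Algebra ℂ S]
    {X : Submodule ℂ R} {E : Submodule ℂ S} (hX : (⊤ : Submodule ℂ R) = 1 + X * ⊤)
    (hE : (⊤ : Submodule ℂ S) = 1 + E * ⊤) :
    (⊤ : Submodule ℂ (R ⊗[ℂ] S)) =
      1 + (X.map (includeLeft : R →ₐ[ℂ] R ⊗[ℂ] S).toLinearMap ⊔
        E.map (includeRight : S →ₐ[ℂ] R ⊗[ℂ] S).toLinearMap) * ⊤ := by
  set Y := X.map (includeLeft : R →ₐ[ℂ] R ⊗[ℂ] S).toLinearMap ⊔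
        E.map (includeRight : S →ₐ[ℂ] R ⊗[ℂ] S).toLinearMap
  refine le_antisymm (fun a _ => ?_) le_top
  induction a with
  | zero => exact zero_mem _
  | add a b ha hb => exact Submodule.add_mem _ (ha trivial) (hb trivial)
  | tmul r s =>
    have hr := map_mem_one_add_mul_top hX (includeLeft : R →ₐ[ℂ] R ⊗[ℂ] S)
      (le_sup_left : _ ≤ Y) r
    have hs := map_mem_one_add_mul_top hE (includeRight : S →ₐ[ℂ] R ⊗[ℂ] S)
      (le_sup_right : _ ≤ Y) s
    have : (1 + Y * ⊤) * (1 + Y * ⊤) ≤ 1 + Y * ⊤ := by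
      rw [add_mul, one_mul, mul_assoc]
      exact sup_le le_rfl (le_sup_of_le_right (mul_le_mul' le_rfl le_top))
    have h := this (Submodule.mul_mem_mul hr hs)
    simpa using h

section General

variable {A : Type*} [Ring A]

theorem Submodule.top_eq_sum_pow_add [Algebra ℂ A] {Y : Submodule ℂ A}
    (hY : (⊤ : Submodule ℂ A) = 1 + Y * ⊤) (p : ℕ) :
    (⊤ : Submodule ℂ A) = ∑ k ∈ Finset.range p, Y ^ k + Y ^ p * ⊤ := by
  induction p with
  | zero => simp
  | succ p ih =>
    conv_lhs => rw [ih, hY]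
    rw [mul_add, mul_one, Finset.sum_range_succ, pow_succ, mul_assoc, add_assoc]

theorem Submodule.pow_le_tsiPow [Algebra ℂ A] {Y : Submodule ℂ A} {I : TwoSidedIdeal A}
    (h : Y ≤ tsiToSubmodule I) (p : ℕ) : Y ^ (p + 1) ≤ tsiToSubmodule (tsiPow I (p + 1)) := by
  induction p with
  | zero => simpa [tsiPow] using h
  | succ p ih =>
    rw [pow_succ]
    exact Submodule.mul_le.2 fun a ha b hb => TwoSidedIdeal.subset_span ⟨a, ih ha, b, h hb, rfl⟩

theorem finiteDimensional_of_tsiPow_le [Algebra ℂ A] {Y : Submodule ℂ A} (hfg : Y.FG)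
    (hY : (⊤ : Submodule ℂ A) = 1 + Y * ⊤) {I J : TwoSidedIdeal A}
    (hI : Y ≤ tsiToSubmodule I) {p : ℕ} (hp : 0 < p) (hJ : tsiPow I p ≤ J) :
    FiniteDimensional ℂ (A ⧸ tsiToSubmodule J) := by
  obtain ⟨p, rfl⟩ := Nat.exists_eq_succ_of_ne_zero hp.ne'
  set W := ∑ k ∈ Finset.range (p + 1), Y ^ k with hW
  have hWfg : W.FG := by
    rw [hW]
    refine Finset.sum_induction _ Submodule.FG (fun _ _ => Submodule.FG.sup) Submodule.fg_bot
      fun k _ => hfg.pow k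
  have hle : Y ^ (p + 1) * ⊤ ≤ tsiToSubmodule J := Submodule.mul_le.2 fun a ha b _ =>
    J.mul_mem_right _ _ (hJ (Submodule.pow_le_tsiPow hI p ha))
  have htop : W.map (tsiToSubmodule J).mkQ = ⊤ := by
    rw [← Submodule.range_mkQ (tsiToSubmodule J), LinearMap.range_eq_map,
      Submodule.top_eq_sum_pow_add hY (p + 1), Submodule.add_eq_sup, Submodule.map_sup]
    refine (sup_eq_left.2 ?_).symm
    rintro _ ⟨x, hx, rfl⟩
    rw [Submodule.mkQ_apply, (Submodule.Quotient.mk_eq_zero _).2 (hle hx)]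
    exact zero_mem _
  exact ⟨htop ▸ hWfg.map _⟩

theorem map_mem_pow_of_mem_tsiPow {B : Type*} [Ring B] (f : A →+* B) {I : TwoSidedIdeal A}
    {N : Ideal B} [N.IsTwoSided] (h : ∀ x ∈ I, f x ∈ N) (p : ℕ) :
    ∀ x ∈ tsiPow I (p + 1), f x ∈ N ^ (p + 1) := by
  induction p with
  | zero => simpa [tsiPow, Submodule.pow_one] using h
  | succ p ih =>
    have : tsiPow I (p + 2) ≤ (N ^ (p + 2)).toTwoSided.comap f := by
      refine TwoSidedIdeal.span_le.2 ?_
      rintro _ ⟨a, ha, b, hb, rfl⟩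
      show _ ∈ TwoSidedIdeal.comap _ _
      rw [TwoSidedIdeal.mem_comap, Ideal.mem_toTwoSided, map_mul, Submodule.pow_succ]
      exact Ideal.mul_mem_mul (ih a ha) (h b hb)
    intro x hx
    have := this hx
    rwa [TwoSidedIdeal.mem_comap, Ideal.mem_toTwoSided] at this

theorem mem_jacobson_bot_of_forall_isNilpotent {B : Type*} [Ring B] {y : B}
    (h : ∀ b, IsNilpotent (b * y)) : y ∈ Ideal.jacobson (⊥ : Ideal B) := by
  refine Ideal.mem_jacobson_iff.2 fun b => ?_
  obtain ⟨u, hu⟩ := (h b).isUnit_one_add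
  refine ⟨(u⁻¹ : Bˣ), ?_⟩
  rw [Ideal.mem_bot, mul_assoc, sub_eq_zero]
  calc _ = (u⁻¹ : Bˣ) * (1 + b * y) := by rw [mul_add, mul_one, add_comm]
    _ = 1 := by rw [← hu, Units.inv_mul]

theorem exists_tsiPow_le_of_forall_isNilpotent [Algebra ℂ A] {J : TwoSidedIdeal A} {s : Set A}
    [FiniteDimensional ℂ J.ringCon.Quotient]
    (h : ∀ y ∈ s, ∀ a, IsNilpotent (J.ringCon.mk' (a * y))) :
    ∃ p, 0 < p ∧ tsiPow (TwoSidedIdeal.span s) p ≤ J := by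
  have : IsArtinianRing J.ringCon.Quotient := IsArtinianRing.of_finite ℂ _
  obtain ⟨p, hp⟩ := IsArtinianRing.isNilpotent_jacobson_bot (R := J.ringCon.Quotient)
  set N := Ideal.jacobson (⊥ : Ideal J.ringCon.Quotient)
  have hspan : TwoSidedIdeal.span s ≤ N.toTwoSided.comap J.ringCon.mk' := by
    refine TwoSidedIdeal.span_le.2 fun y hy => ?_
    show _ ∈ TwoSidedIdeal.comap _ _
    rw [TwoSidedIdeal.mem_comap, Ideal.mem_toTwoSided]
    refine mem_jacobson_bot_of_forall_isNilpotent fun b => ?_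
    obtain ⟨a, rfl⟩ := J.ringCon.mk'_surjective b
    rw [← map_mul]
    exact h y hy a
  refine ⟨p + 1, p.succ_pos, fun x hx => ?_⟩
  have hx' := map_mem_pow_of_mem_tsiPow J.ringCon.mk' (N := N) (fun x hx => by
    have := hspan hx
    rwa [TwoSidedIdeal.mem_comap, Ideal.mem_toTwoSided] at this) p x hx
  rw [Submodule.pow_succ, hp, Submodule.zero_eq_bot, Submodule.bot_mul] at hx'
  rw [← TwoSidedIdeal.ker_ringCon_mk' J, TwoSidedIdeal.mem_ker]
  exact hx'

theorem finiteDimensional_ringCon_quotient [Algebra ℂ A] (J : TwoSidedIdeal A)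
    [FiniteDimensional ℂ (A ⧸ tsiToSubmodule J)] : FiniteDimensional ℂ J.ringCon.Quotient := by
  let π : A →ₗ[ℂ] J.ringCon.Quotient :=
    { J.ringCon.mk' with map_smul' := fun _ _ => rfl }
  have hπ : tsiToSubmodule J ≤ LinearMap.ker π := fun x hx => by
    rw [← SetLike.mem_coe] at hx
    have : x ∈ TwoSidedIdeal.ker J.ringCon.mk' := by rwa [TwoSidedIdeal.ker_ringCon_mk']
    exact (TwoSidedIdeal.mem_ker J.ringCon.mk').1 this
  refine Module.Finite.of_surjective ((tsiToSubmodule J).liftQ π hπ) fun b => ?_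
  obtain ⟨a, rfl⟩ := J.ringCon.mk'_surjective b
  exact ⟨Submodule.Quotient.mk a, rfl⟩

end General

/-- A germ vanishing at `0` is nilpotent in every finite-dimensional algebra. -/
theorem isNilpotent_map_of_mem_vanishingIdeal {n : ℕ} {B : Type*} [Ring B] [Algebra ℂ B]
    [FiniteDimensional ℂ B] (f : analyticGerms n →ₐ[ℂ] B) {r : analyticGerms n}
    (hr : r ∈ vanishingIdeal n) : IsNilpotent (f r) := by
  obtain ⟨P, hP, hPr⟩ := Algebra.IsAlgebraic.isAlgebraic (R := ℂ) (f r)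
  obtain ⟨Q, hQ, hdvd⟩ := P.exists_eq_pow_rootMultiplicity_mul_and_not_dvd hP 0
  have hu : IsUnit (Polynomial.aeval r Q) := by
    refine isUnit_of_evalAtZero_ne_zero ?_
    have h0 : evalAtZero n r = 0 := hr
    have : evalAtZero n (Polynomial.aeval r Q) = Q.eval 0 := by
      rw [Polynomial.aeval_def, Polynomial.hom_eval₂, h0, Polynomial.eval]
      congr 1
    rw [this]
    rwa [Polynomial.dvd_iff_isRoot] at hdvd
  refine ⟨P.rootMultiplicity 0, ?_⟩
  rw [hQ, map_mul, Polynomial.aeval_algHom_apply f r Q] at hPr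
  simpa using (hu.map f).mul_left_eq_zero.1 hPr

theorem ExteriorAlgebra.exists_ι_mul_eq {V : Type*} [AddCommGroup V] [Module ℂ V] (v : V)
    (a : ExteriorAlgebra ℂ V) : ∃ b, ι ℂ v * a = b * ι ℂ v := by
  induction a using ExteriorAlgebra.induction with
  | algebraMap r => exact ⟨_, (Algebra.commutes r _).symm⟩
  | ι x => exact ⟨-ι ℂ x, by rw [neg_mul]; exact eq_neg_of_add_eq_zero_left (ι_add_mul_swap v x)⟩
  | mul a b ha hb =>
    obtain ⟨a', ha⟩ := ha
    obtain ⟨b', hb⟩ := hb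
    exact ⟨a' * b', by rw [← mul_assoc, ha, mul_assoc, hb, mul_assoc]⟩
  | add a b ha hb =>
    obtain ⟨a', ha⟩ := ha
    obtain ⟨b', hb⟩ := hb
    exact ⟨a' + b', by rw [mul_add, ha, hb, add_mul]⟩

theorem one_tmul_ι_mul_mul_self {n m : ℕ} (v : Fin m → ℂ) (a : SuperStalk n m) :
    (1 : analyticGerms n) ⊗ₜ[ℂ] ExteriorAlgebra.ι ℂ v * a *
      (1 : analyticGerms n) ⊗ₜ[ℂ] ExteriorAlgebra.ι ℂ v = 0 := by
  induction a using TensorProduct.induction_on with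
  | zero => simp
  | add a b ha hb => rw [mul_add, add_mul, ha, hb, add_zero]
  | tmul r s =>
    obtain ⟨b, hb⟩ := ExteriorAlgebra.exists_ι_mul_eq v s
    rw [Algebra.TensorProduct.tmul_mul_tmul, Algebra.TensorProduct.tmul_mul_tmul, hb, mul_assoc b,
      ExteriorAlgebra.ι_sq_zero, mul_zero, TensorProduct.tmul_zero]

/-- A two-sided ideal `J` of the stalk at the origin of `ℂ^{n|m}` has finite codimension
if and only if it contains some positive power of the maximal two-sided ideal `J₀` of
sections vanishing at the origin. -/
theorem superStalk_finite_codimension_iff (n m : ℕ) (J : TwoSidedIdeal (SuperStalk n m)) :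
    FiniteDimensional ℂ (SuperStalk n m ⧸ tsiToSubmodule J) ↔
      ∃ p : ℕ, 0 < p ∧ tsiPow (superVanishingIdeal n m) p ≤ J := by
  constructor
  · intro hfin
    have := finiteDimensional_ringCon_quotient J
    refine exists_tsiPow_le_of_forall_isNilpotent ?_
    rintro _ (⟨r, hr, rfl⟩ | ⟨v, rfl⟩) a
    · rw [map_mul]
      have hcomm : Commute a (r ⊗ₜ[ℂ] (1 : ExteriorAlgebra ℂ (Fin m → ℂ))) := by
        induction a using TensorProduct.induction_on with
        | zero => exact Commute.zero_left _
        | add a b ha hb => exact ha.add_left hb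
        | tmul r' s => simp [Commute, SemiconjBy, mul_comm]
      exact (hcomm.map J.ringCon.mk').isNilpotent_mul_left
        (isNilpotent_map_of_mem_vanishingIdeal (B := J.ringCon.Quotient) ((J.ringCon.mkₐ ℂ).comp
          (Algebra.TensorProduct.includeLeft : analyticGerms n →ₐ[ℂ] SuperStalk n m)) hr :)
    · refine IsNilpotent.map ⟨2, ?_⟩ _
      rw [pow_two, mul_assoc, ← mul_assoc _ a, one_tmul_ι_mul_mul_self, mul_zero]
  · rintro ⟨p, hp, hJ⟩
    refine finiteDimensional_of_tsiPow_le ?_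
      (tensorProduct_top_eq (analyticGerms_top_eq n) (exteriorAlgebra_top_eq (Fin m → ℂ))) ?_ hp hJ
    · refine Submodule.FG.sup (Submodule.FG.map _ (Submodule.fg_span (Set.finite_range _)))
        (Submodule.FG.map _ ?_)
      rw [LinearMap.range_eq_map]
      exact Module.Finite.fg_top.map _
    · refine sup_le ?_ ?_
      · rw [Submodule.map_span, Submodule.span_le]
        rintro _ ⟨_, ⟨i, rfl⟩, rfl⟩
        exact TwoSidedIdeal.subset_span (Or.inl ⟨_, coordGerm_mem_vanishingIdeal n i, rfl⟩)
      · rintro _ ⟨_, ⟨v, rfl⟩, rfl⟩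
        exact TwoSidedIdeal.subset_span (Or.inr ⟨v, rfl⟩)
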